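/- Fix a nonempty finite action set A. For every ε > 0 there exists N such that for every finite state set Ω with |Ω| ≥ N, every finite message set M with |M| > max{|Ω|, |A|}, and every interior prior μ₀ on Ω, the share of environments (u_S, u_R) such that commitment has no value lies within ε of 1/|A|^{|A|}. -/

import Mathlib

open MeasureTheory

namespace KL

/-- `f` is a probability distribution on the finite type `X`. -/
def IsDist {X : Type} [Fintype X] (f : X → ℝ) : Prop :=
  (∀ x, 0 ≤ f x) ∧ ∑ x, f x = 1

/-- `μ₀` is an interior prior on `Ω`. -/
def IsPrior {Ω : Type} [Fintype Ω] (μ₀ : Ω → ℝ) : Prop :=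
  (∀ ω, 0 < μ₀ ω) ∧ ∑ ω, μ₀ ω = 1

variable {Ω A M : Type} [Fintype Ω] [Fintype A] [Fintype M]

/-- A messaging strategy: a distribution over messages in each state. -/
def IsMsg (σ : Ω → M → ℝ) : Prop := ∀ ω, IsDist (σ ω)

/-- An action strategy: a distribution over actions after each message. -/
def IsAct (ρ : M → A → ℝ) : Prop := ∀ m, IsDist (ρ m)

/-- Expected payoff of a profile `(σ, ρ)` for utility `u`. -/
def U (μ₀ : Ω → ℝ) (u : A × Ω → ℝ) (σ : Ω → M → ℝ) (ρ : M → A → ℝ) : ℝ :=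
  ∑ ω, ∑ m, ∑ a, μ₀ ω * σ ω m * ρ m a * u (a, ω)

/-- Sender best response. -/
def SBR (μ₀ : Ω → ℝ) (uS : A × Ω → ℝ) (σ : Ω → M → ℝ) (ρ : M → A → ℝ) : Prop :=
  ∀ σ' : Ω → M → ℝ, IsMsg σ' → U μ₀ uS σ' ρ ≤ U μ₀ uS σ ρ

/-- Receiver best response. -/
def RBR (μ₀ : Ω → ℝ) (uR : A × Ω → ℝ) (σ : Ω → M → ℝ) (ρ : M → A → ℝ) : Prop :=
  ∀ ρ' : M → A → ℝ, IsAct ρ' → U μ₀ uR σ ρ' ≤ U μ₀ uR σ ρ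

/-- A cheap-talk equilibrium: a profile of valid strategies that is S-BR and R-BR. -/
def CTEq (μ₀ : Ω → ℝ) (uS uR : A × Ω → ℝ) (σ : Ω → M → ℝ) (ρ : M → A → ℝ) : Prop :=
  IsMsg σ ∧ IsAct ρ ∧ SBR μ₀ uS σ ρ ∧ RBR μ₀ uR σ ρ

/-- A persuasion profile: a profile of valid strategies that is R-BR. -/
def PersProfile (μ₀ : Ω → ℝ) (uR : A × Ω → ℝ) (σ : Ω → M → ℝ) (ρ : M → A → ℝ) : Prop :=
  IsMsg σ ∧ IsAct ρ ∧ RBR μ₀ uR σ ρ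

/-- The cheap-talk payoff: the maximal Sender payoff over cheap-talk equilibria. -/
noncomputable def ctPayoff (μ₀ : Ω → ℝ) (uS uR : A × Ω → ℝ) : ℝ :=
  sSup {x | ∃ (σ : Ω → M → ℝ) (ρ : M → A → ℝ), CTEq μ₀ uS uR σ ρ ∧ x = U μ₀ uS σ ρ}

/-- The (Bayesian) persuasion payoff: the maximal Sender payoff over persuasion profiles. -/
noncomputable def persPayoff (μ₀ : Ω → ℝ) (uS uR : A × Ω → ℝ) : ℝ :=
  sSup {x | ∃ (σ : Ω → M → ℝ) (ρ : M → A → ℝ), PersProfile μ₀ uR σ ρ ∧ x = U μ₀ uS σ ρ}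

/-- A messaging strategy is partitional if it is deterministic in every state. -/
def Partitional (σ : Ω → M → ℝ) : Prop := ∀ ω, ∃ m, σ ω m = 1

/-- The partitional persuasion payoff. -/
noncomputable def partPersPayoff (μ₀ : Ω → ℝ) (uS uR : A × Ω → ℝ) : ℝ :=
  sSup {x | ∃ (σ : Ω → M → ℝ) (ρ : M → A → ℝ),
    Partitional σ ∧ PersProfile μ₀ uR σ ρ ∧ x = U μ₀ uS σ ρ}

/-- The partitional cheap-talk payoff. -/
noncomputable def partCtPayoff (μ₀ : Ω → ℝ) (uS uR : A × Ω → ℝ) : ℝ :=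
  sSup {x | ∃ (σ : Ω → M → ℝ) (ρ : M → A → ℝ),
    Partitional σ ∧ CTEq μ₀ uS uR σ ρ ∧ x = U μ₀ uS σ ρ}

/-- A message is on-path if it is sent with positive probability in some state. -/
def OnPath (σ : Ω → M → ℝ) (m : M) : Prop := ∃ ω, 0 < σ ω m

/-- A pure action strategy: degenerate after every message. -/
def IsPureAct (ρ : M → A → ℝ) : Prop := ∀ m, ∃ a, ρ m a = 1

/-- A pure-on-path action strategy: degenerate after every on-path message. -/
def PureOnPath (σ : Ω → M → ℝ) (ρ : M → A → ℝ) : Prop :=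
  ∀ m, OnPath σ m → ∃ a, ρ m a = 1

/-- The posterior belief induced by message `m`. -/
noncomputable def post (μ₀ : Ω → ℝ) (σ : Ω → M → ℝ) (m : M) (ω : Ω) : ℝ :=
  μ₀ ω * σ ω m / ∑ ω', μ₀ ω' * σ ω' m

/-- The cube of environments `[0,1]^(2|A||Ω|)`. -/
def EnvCube (Ω A : Type) : Set ((A × Ω → ℝ) × (A × Ω → ℝ)) :=
  {e | (∀ p, e.1 p ∈ Set.Icc (0 : ℝ) 1) ∧ ∀ p, e.2 p ∈ Set.Icc (0 : ℝ) 1}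

/-- The cube of transparent environments `[0,1]^(|A|(|Ω|+1))`, points `(v, u_R)`. -/
def TransCube (Ω A : Type) : Set ((A → ℝ) × (A × Ω → ℝ)) :=
  {e | (∀ a, e.1 a ∈ Set.Icc (0 : ℝ) 1) ∧ ∀ p, e.2 p ∈ Set.Icc (0 : ℝ) 1}

open Classical in
/-- The expanded-indifference matrix `T^i`: rows `u_S(a_j,·) − u_S(a_i,·)` for `j ≠ i`,
rows `u_R(a_j,·) − u_R(a_i,·)` for `j ≠ i`, and the rows of the identity matrix. -/
noncomputable def TMat (uS uR : A × Ω → ℝ) (i : A) :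
    Matrix (({j : A // j ≠ i} ⊕ {j : A // j ≠ i}) ⊕ Ω) Ω ℝ :=
  Matrix.of fun r ω =>
    match r with
    | Sum.inl (Sum.inl j) => uS (j.1, ω) - uS (i, ω)
    | Sum.inl (Sum.inr j) => uR (j.1, ω) - uR (i, ω)
    | Sum.inr ω' => if ω' = ω then 1 else 0

/-- Scant indifferences: every row-submatrix of every expanded-indifference matrix has
full rank (rank equal to the minimum of the number of rows and the number of columns). -/
def ScantIndiff (uS uR : A × Ω → ℝ) : Prop :=
  ∀ i : A, ∀ s : Finset (({j : A // j ≠ i} ⊕ {j : A // j ≠ i}) ⊕ Ω),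
    ((TMat uS uR i).submatrix (fun r : {x // x ∈ s} => r.1) id).rank
      = min s.card (Fintype.card Ω)

open Classical in
/-- The set `Ω_a` of states in which `a` is an ideal action for Sender. -/
noncomputable def idealStates (uS : A × Ω → ℝ) (a : A) : Finset Ω :=
  Finset.univ.filter fun ω => ∀ b, uS (b, ω) ≤ uS (a, ω)

/-- Felicitous environment. -/
def Felicitous (μ₀ : Ω → ℝ) (uS uR : A × Ω → ℝ) : Prop :=
  ∀ a a' : A, 0 ≤ ∑ ω ∈ idealStates uS a, μ₀ ω * (uR (a, ω) - uR (a', ω))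

/-- Partitional-unique-response: for every nonempty subset of states, Receiver's
expected payoff has a unique maximizer. -/
def PUR (μ₀ : Ω → ℝ) (uR : A × Ω → ℝ) : Prop :=
  ∀ S : Finset Ω, S.Nonempty →
    ∃! a : A, ∀ b : A, ∑ ω ∈ S, μ₀ ω * uR (b, ω) ≤ ∑ ω ∈ S, μ₀ ω * uR (a, ω)

/-- Jointly-inclusive environment: each action is the unique ideal action of both
players in some state. -/
def JointlyInclusive (uS uR : A × Ω → ℝ) : Prop :=
  ∀ a : A, ∃ ω : Ω,
    (∀ b, b ≠ a → uS (b, ω) < uS (a, ω)) ∧ ∀ b, b ≠ a → uR (b, ω) < uR (a, ω)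

/-! ### Game-theoretic part -/

theorem simplex_opt {I J : Type} [Fintype I] [Fintype J] (Q : I → J → ℝ) (x : I → J → ℝ)
    (hx : ∀ i, IsDist (x i))
    (hopt : ∀ y : I → J → ℝ, (∀ i, IsDist (y i)) →
      ∑ i, ∑ j, y i j * Q i j ≤ ∑ i, ∑ j, x i j * Q i j)
    (i : I) (j k : J) (hpos : 0 < x i j) : Q i k ≤ Q i j := by
  classical
  set y : I → J → ℝ := fun i' l => x i' l +
    if i' = i then x i j * ((if l = k then 1 else 0) - (if l = j then 1 else 0)) else 0 with hy
  have h1 : ∀ i', IsDist (y i') := by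
    intro i'
    by_cases hi : i' = i
    · subst hi
      refine ⟨fun l => ?_, ?_⟩
      · have := (hx i').1 l
        simp only [hy, if_true]
        by_cases h1 : l = k
        · subst h1
          by_cases h2 : l = j
          · simp [h2]; subst h2; exact this
          · simp [h2]; linarith
        · by_cases h2 : l = j
          · subst h2; simp [h1]
          · simp [h1, h2]; exact this
      · have := (hx i').2
        simp [hy, Finset.sum_add_distrib, ← Finset.mul_sum, this]
    · simpa [hy, hi, IsDist] using hx i'
  have h2 := hopt y h1
  have h3 : ∑ i', ∑ l, y i' l * Q i' l
      = ∑ i', ∑ l, x i' l * Q i' l + x i j * (Q i k - Q i j) := by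
    simp only [hy, add_mul, Finset.sum_add_distrib]
    congr 1
    rw [Finset.sum_eq_single i]
    · simp only [if_true, mul_assoc, ← Finset.mul_sum, sub_mul, Finset.sum_sub_distrib]
      simp
    · intro b _ hb
      simp [hb]
    · simp
  rw [h3] at h2
  by_contra hc
  push Not at hc
  nlinarith [mul_pos hpos (sub_pos.2 hc)]

theorem U_eq_act (μ₀ : Ω → ℝ) (u : A × Ω → ℝ) (σ : Ω → M → ℝ) (ρ : M → A → ℝ) :
    U μ₀ u σ ρ = ∑ m, ∑ a, ρ m a * ∑ ω, μ₀ ω * σ ω m * u (a, ω) := by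
  unfold U
  rw [Finset.sum_comm]
  refine Finset.sum_congr rfl fun m _ => ?_
  rw [Finset.sum_comm]
  refine Finset.sum_congr rfl fun a _ => ?_
  rw [Finset.mul_sum]
  exact Finset.sum_congr rfl fun ω _ => by ring

theorem U_eq_msg (μ₀ : Ω → ℝ) (u : A × Ω → ℝ) (σ : Ω → M → ℝ) (ρ : M → A → ℝ) :
    U μ₀ u σ ρ = ∑ ω, ∑ m, σ ω m * (μ₀ ω * ∑ a, ρ m a * u (a, ω)) := by
  unfold U
  refine Finset.sum_congr rfl fun ω _ => Finset.sum_congr rfl fun m _ => ?_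
  rw [Finset.mul_sum, Finset.mul_sum]
  exact Finset.sum_congr rfl fun a _ => by ring

theorem rbr_local {μ₀ : Ω → ℝ} {uR : A × Ω → ℝ} {σ : Ω → M → ℝ} {ρ : M → A → ℝ}
    (hρ : IsAct ρ) (h : RBR μ₀ uR σ ρ) (m : M) (a c : A) (hpos : 0 < ρ m a) :
    ∑ ω, μ₀ ω * σ ω m * uR (c, ω) ≤ ∑ ω, μ₀ ω * σ ω m * uR (a, ω) := by
  refine simplex_opt (fun m a => ∑ ω, μ₀ ω * σ ω m * uR (a, ω)) ρ hρ ?_ m a c hpos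
  intro y hy
  have := h y hy
  rwa [U_eq_act, U_eq_act] at this

theorem sbr_local {μ₀ : Ω → ℝ} (hμ : IsPrior μ₀) {uS : A × Ω → ℝ} {σ : Ω → M → ℝ}
    {ρ : M → A → ℝ}
    (hσ : IsMsg σ) (h : SBR μ₀ uS σ ρ) (ω : Ω) (m m' : M) (hpos : 0 < σ ω m) :
    ∑ a, ρ m' a * uS (a, ω) ≤ ∑ a, ρ m a * uS (a, ω) := by
  have := simplex_opt (fun ω m => μ₀ ω * ∑ a, ρ m a * uS (a, ω)) σ hσ ?_ ω m m' hpos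
  · exact le_of_mul_le_mul_left this (hμ.1 ω)
  intro y hy
  have := h y hy
  rwa [U_eq_msg, U_eq_msg] at this

/-- Sender's value of an outcome. -/
def Vout (u : A × Ω → ℝ) (p : A → Ω → ℝ) : ℝ := ∑ a, ∑ ω, p a ω * u (a, ω)

/-- Obedient outcomes. -/
def Obed (μ₀ : Ω → ℝ) (uR : A × Ω → ℝ) (p : A → Ω → ℝ) : Prop :=
  (∀ a ω, 0 ≤ p a ω) ∧ (∀ ω, ∑ a, p a ω = μ₀ ω) ∧
    ∀ a c, 0 ≤ ∑ ω, p a ω * (uR (a, ω) - uR (c, ω))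

theorem pers_of_obed [Nonempty A] {μ₀ : Ω → ℝ} (hμ : IsPrior μ₀) {uR : A × Ω → ℝ}
    {p : A → Ω → ℝ} (hcard : Fintype.card A ≤ Fintype.card M) (hp : Obed μ₀ uR p) :
    ∃ (σ : Ω → M → ℝ) (ρ : M → A → ℝ), PersProfile μ₀ uR σ ρ ∧
      ∀ u, U μ₀ u σ ρ = Vout u p := by
  classical
  obtain ⟨ι⟩ := Function.Embedding.nonempty_of_card_le hcard
  obtain ⟨hp0, hp1, hp2⟩ := hp
  set σ : Ω → M → ℝ := fun ω m => ∑ a, if ι a = m then p a ω / μ₀ ω else 0 with hσ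
  set ρ : M → A → ℝ := fun m a => if Function.invFun ι m = a then 1 else 0 with hρ
  have hU : ∀ u (ρ' : M → A → ℝ), U μ₀ u σ ρ' = ∑ a, ∑ b, ρ' (ι a) b * ∑ ω, p a ω * u (b, ω) := by
    intro u ρ'
    have e1 : ∀ ω, ∑ m, σ ω m * (μ₀ ω * ∑ a, ρ' m a * u (a, ω))
        = ∑ a, p a ω * ∑ b, ρ' (ι a) b * u (b, ω) := by
      intro ω
      simp only [hσ, Finset.sum_mul]
      rw [Finset.sum_comm]
      refine Finset.sum_congr rfl fun a _ => ?_
      simp only [ite_mul, zero_mul, Finset.sum_ite_eq, Finset.mem_univ, if_true]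
      have := (hμ.1 ω).ne'
      field_simp
    rw [U_eq_msg]
    simp only [e1]
    rw [Finset.sum_comm]
    refine Finset.sum_congr rfl fun a _ => ?_
    simp only [Finset.mul_sum]
    rw [Finset.sum_comm]
    exact Finset.sum_congr rfl fun b _ => Finset.sum_congr rfl fun ω _ => by ring
  have hUρ : ∀ u, U μ₀ u σ ρ = Vout u p := by
    intro u
    rw [hU]
    simp [hρ, Function.leftInverse_invFun ι.injective _, Vout]
  refine ⟨σ, ρ, ⟨?_, ?_, ?_⟩, hUρ⟩
  · intro ω
    refine ⟨fun m => Finset.sum_nonneg fun a _ => ?_, ?_⟩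
    · split_ifs
      · exact div_nonneg (hp0 _ _) (hμ.1 ω).le
      · exact le_rfl
    · simp only [hσ]
      rw [Finset.sum_comm]
      simp only [Finset.sum_ite_eq, Finset.mem_univ, if_true]
      rw [← Finset.sum_div, hp1, div_self (hμ.1 ω).ne']
  · intro m
    refine ⟨fun a => ?_, ?_⟩
    · simp only [hρ]; split_ifs <;> norm_num
    · simp [hρ]
  · intro ρ' hρ'
    rw [hUρ, hU]
    unfold Vout
    refine Finset.sum_le_sum fun a _ => ?_
    have : ∑ ω, p a ω * uR (a, ω) = ∑ b, ρ' (ι a) b * ∑ ω, p a ω * uR (a, ω) := by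
      rw [← Finset.sum_mul, (hρ' (ι a)).2, one_mul]
    rw [this]
    refine Finset.sum_le_sum fun b _ => mul_le_mul_of_nonneg_left ?_ ((hρ' (ι a)).1 b)
    have := hp2 a b
    simp only [mul_sub, Finset.sum_sub_distrib] at this
    linarith

/-- The outcome induced by a profile. -/
def outc (μ₀ : Ω → ℝ) (σ : Ω → M → ℝ) (ρ : M → A → ℝ) : A → Ω → ℝ :=
  fun a ω => ∑ m, μ₀ ω * σ ω m * ρ m a

theorem Vout_outc (μ₀ : Ω → ℝ) (σ : Ω → M → ℝ) (ρ : M → A → ℝ) (u : A × Ω → ℝ) :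
    Vout u (outc μ₀ σ ρ) = U μ₀ u σ ρ := by
  unfold Vout outc U
  rw [Finset.sum_comm]
  refine Finset.sum_congr rfl fun ω _ => ?_
  simp only [Finset.sum_mul]
  rw [Finset.sum_comm]

theorem isDist_le_one {X : Type} [Fintype X] {f : X → ℝ} (h : IsDist f) (x : X) : f x ≤ 1 := by
  rw [← h.2]
  exact Finset.single_le_sum (fun i _ => h.1 i) (Finset.mem_univ x)

theorem isCompact_dists {I J : Type} [Fintype I] [Fintype J] :
    IsCompact {x : I → J → ℝ | ∀ i, IsDist (x i)} := by
  have : {x : I → J → ℝ | ∀ i, IsDist (x i)} = Set.univ.pi fun _ => stdSimplex ℝ J := by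
    ext x
    simp [IsDist, stdSimplex]
  rw [this]
  exact isCompact_univ_pi fun _ => isCompact_stdSimplex ℝ J

theorem continuous_U (μ₀ : Ω → ℝ) (u : A × Ω → ℝ) :
    Continuous fun x : (Ω → M → ℝ) × (M → A → ℝ) => U μ₀ u x.1 x.2 := by
  unfold U
  fun_prop

theorem isCompact_pers (μ₀ : Ω → ℝ) (uR : A × Ω → ℝ) :
    IsCompact {x : (Ω → M → ℝ) × (M → A → ℝ) | PersProfile μ₀ uR x.1 x.2} := by
  have h : {x : (Ω → M → ℝ) × (M → A → ℝ) | PersProfile μ₀ uR x.1 x.2} =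
      ({x : Ω → M → ℝ | ∀ i, IsDist (x i)} ×ˢ {x : M → A → ℝ | ∀ i, IsDist (x i)}) ∩
      {x | RBR μ₀ uR x.1 x.2} := by
    ext x
    simp only [PersProfile, IsMsg, IsAct, Set.mem_ofPred_eq, Set.mem_inter_iff, Set.mem_prod,
      and_assoc]
  rw [h]
  refine (isCompact_dists.prod isCompact_dists).inter_right ?_
  simp only [RBR, Set.ofPred_forall]
  refine isClosed_iInter fun ρ' => isClosed_iInter fun _ => isClosed_le ?_ (continuous_U _ _)
  unfold U
  fun_prop

theorem isCompact_ct (μ₀ : Ω → ℝ) (uS uR : A × Ω → ℝ) :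
    IsCompact {x : (Ω → M → ℝ) × (M → A → ℝ) | CTEq μ₀ uS uR x.1 x.2} := by
  have h : {x : (Ω → M → ℝ) × (M → A → ℝ) | CTEq μ₀ uS uR x.1 x.2} =
      {x | PersProfile μ₀ uR x.1 x.2} ∩ {x | SBR μ₀ uS x.1 x.2} := by
    ext x
    simp only [PersProfile, CTEq, Set.mem_ofPred_eq, Set.mem_inter_iff]
    tauto
  rw [h]
  refine (isCompact_pers μ₀ uR).inter_right ?_
  simp only [SBR, Set.ofPred_forall]
  refine isClosed_iInter fun ρ' => isClosed_iInter fun _ => isClosed_le ?_ (continuous_U _ _)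
  unfold U
  fun_prop

theorem exists_ct [Nonempty A] [Nonempty M] (μ₀ : Ω → ℝ) (uS uR : A × Ω → ℝ) :
    ∃ (σ : Ω → M → ℝ) (ρ : M → A → ℝ), CTEq μ₀ uS uR σ ρ := by
  classical
  obtain ⟨m₀⟩ := ‹Nonempty M›
  obtain ⟨a₀, -, ha₀⟩ := Finset.exists_max_image (Finset.univ : Finset A)
    (fun a => ∑ ω, μ₀ ω * uR (a, ω)) Finset.univ_nonempty
  refine ⟨fun _ m => if m = m₀ then 1 else 0, fun _ a => if a = a₀ then 1 else 0, ?_, ?_, ?_, ?_⟩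
  · intro ω
    refine ⟨fun m => ?_, by simp⟩
    dsimp only
    split_ifs <;> norm_num
  · intro ω
    refine ⟨fun m => ?_, by simp⟩
    dsimp only
    split_ifs <;> norm_num
  · intro σ' hσ'
    rw [U_eq_msg, U_eq_msg]
    refine Finset.sum_le_sum fun ω _ => ?_
    rw [← Finset.sum_mul, ← Finset.sum_mul, (hσ' ω).2]
    simp
  · intro ρ' hρ'
    rw [U_eq_act, U_eq_act]
    rw [Finset.sum_eq_single m₀, Finset.sum_eq_single m₀]
    · simp only [if_true, mul_one, ite_mul, one_mul, zero_mul, Finset.sum_ite_eq', Finset.mem_univ]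
      calc _ ≤ ∑ a, ρ' m₀ a * ∑ ω, μ₀ ω * uR (a₀, ω) :=
            Finset.sum_le_sum fun a _ =>
              mul_le_mul_of_nonneg_left (ha₀ a (Finset.mem_univ a)) ((hρ' m₀).1 a)
        _ = _ := by rw [← Finset.sum_mul, (hρ' m₀).2, one_mul]
    · intro b _ hb; simp [hb]
    · simp
    · intro b _ hb; simp [hb]
    · simp

theorem le_persPayoff {μ₀ : Ω → ℝ} {uS uR : A × Ω → ℝ} {σ : Ω → M → ℝ} {ρ : M → A → ℝ}
    (h : PersProfile μ₀ uR σ ρ) : U μ₀ uS σ ρ ≤ persPayoff (M := M) μ₀ uS uR := by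
  refine le_csSup ?_ ⟨σ, ρ, h, rfl⟩
  have := ((isCompact_pers (M := M) μ₀ uR).image (continuous_U μ₀ uS)).bddAbove
  refine this.mono ?_
  rintro x ⟨σ, ρ, h, rfl⟩
  exact ⟨(σ, ρ), h, rfl⟩

theorem exists_ct_attain [Nonempty A] [Nonempty M] (μ₀ : Ω → ℝ) (uS uR : A × Ω → ℝ) :
    ∃ (σ : Ω → M → ℝ) (ρ : M → A → ℝ), CTEq μ₀ uS uR σ ρ ∧
      U μ₀ uS σ ρ = ctPayoff (M := M) μ₀ uS uR := by
  obtain ⟨σ₀, ρ₀, h₀⟩ := exists_ct (M := M) μ₀ uS uR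
  have hne : Set.Nonempty {x : (Ω → M → ℝ) × (M → A → ℝ) | CTEq μ₀ uS uR x.1 x.2} :=
    ⟨(σ₀, ρ₀), h₀⟩
  have hmx := (isCompact_ct (M := M) μ₀ uS uR).exists_isMaxOn hne
    (continuous_U μ₀ uS).continuousOn
  obtain ⟨⟨σ, ρ⟩, h, hmax⟩ := hmx
  rw [isMaxOn_iff] at hmax
  refine ⟨σ, ρ, h, ?_⟩
  symm
  refine IsGreatest.csSup_eq ⟨⟨σ, ρ, h, rfl⟩, ?_⟩
  rintro x ⟨σ', ρ', h', rfl⟩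
  exact hmax (σ', ρ') h'

/-- `g` picks the strict favourite action in every state. -/
def Fav (u : A × Ω → ℝ) (g : Ω → A) : Prop := ∀ ω b, b ≠ g ω → u (b, ω) < u (g ω, ω)

open Classical in
/-- The states classified as `a` by `g`. -/
noncomputable def cell (g : Ω → A) (a : A) : Finset Ω := Finset.univ.filter fun ω => g ω = a

/-- On each cell `a` of the classification `g`, Receiver finds `k a` optimal. -/
def Fel (μ₀ : Ω → ℝ) (uR : A × Ω → ℝ) (g : Ω → A) (k : A → A) : Prop :=
  ∀ a c : A, ∑ ω ∈ cell g a, μ₀ ω * uR (c, ω) ≤ ∑ ω ∈ cell g a, μ₀ ω * uR (k a, ω)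

theorem no_value_of_fel [Nonempty A] {μ₀ : Ω → ℝ} (hμ : IsPrior μ₀) {uS uR : A × Ω → ℝ}
    {g : Ω → A} (hcard : Fintype.card A ≤ Fintype.card M) (hg : Fav uS g)
    (hf : Fel μ₀ uR g id) :
    ¬ (ctPayoff (M := M) μ₀ uS uR < persPayoff (M := M) μ₀ uS uR) := by
  classical
  obtain ⟨ι⟩ := Function.Embedding.nonempty_of_card_le hcard
  have : Nonempty M := ‹Nonempty A›.map ι
  set V : ℝ := ∑ ω, μ₀ ω * uS (g ω, ω) with hV
  have hle : ∀ ω b, uS (b, ω) ≤ uS (g ω, ω) := by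
    intro ω b
    by_cases hb : b = g ω
    · rw [hb]
    · exact (hg ω b hb).le
  have hub : ∀ (σ : Ω → M → ℝ) (ρ : M → A → ℝ), IsMsg σ → IsAct ρ → U μ₀ uS σ ρ ≤ V := by
    intro σ ρ hσ hρ
    rw [U_eq_msg, hV]
    refine Finset.sum_le_sum fun ω _ => ?_
    calc _ ≤ ∑ m, σ ω m * (μ₀ ω * uS (g ω, ω)) := by
          refine Finset.sum_le_sum fun m _ => mul_le_mul_of_nonneg_left
            (mul_le_mul_of_nonneg_left ?_ (hμ.1 ω).le) ((hσ ω).1 m)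
          calc _ ≤ ∑ a, ρ m a * uS (g ω, ω) := Finset.sum_le_sum fun a _ =>
                mul_le_mul_of_nonneg_left (hle ω a) ((hρ m).1 a)
            _ = _ := by rw [← Finset.sum_mul, (hρ m).2, one_mul]
      _ = _ := by rw [← Finset.sum_mul, (hσ ω).2, one_mul]
  set σ : Ω → M → ℝ := fun ω m => if ι (g ω) = m then 1 else 0 with hσ
  set ρ : M → A → ℝ := fun m a => if Function.invFun ι m = a then 1 else 0 with hρ
  have hσm : IsMsg σ := fun ω => ⟨fun m => by simp only [hσ]; split_ifs <;> norm_num, by simp [hσ]⟩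
  have hρm : IsAct ρ := fun ω => ⟨fun m => by simp only [hρ]; split_ifs <;> norm_num, by simp [hρ]⟩
  have hUρ : ∀ u, U μ₀ u σ ρ = ∑ ω, μ₀ ω * u (g ω, ω) := by
    intro u
    rw [U_eq_msg]
    simp [hσ, hρ, Function.leftInverse_invFun ι.injective _]
  have hct : CTEq μ₀ uS uR σ ρ := by
    refine ⟨hσm, hρm, fun σ' hσ' => ?_, fun ρ' hρ' => ?_⟩
    · rw [hUρ uS]
      exact hub σ' ρ hσ' hρm
    · have e : ∀ ρ' : M → A → ℝ, U μ₀ uR σ ρ' =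
          ∑ a, ∑ c, ρ' (ι a) c * ∑ ω ∈ cell g a, μ₀ ω * uR (c, ω) := by
        intro ρ'
        rw [U_eq_msg]
        simp only [hσ, ite_mul, one_mul, zero_mul, Finset.sum_ite_eq, Finset.mem_univ, if_true]
        rw [← Finset.sum_fiberwise Finset.univ g]
        refine Finset.sum_congr rfl fun a _ => ?_
        simp only [Finset.mul_sum]
        rw [Finset.sum_comm]
        refine Finset.sum_congr rfl fun c _ => ?_
        refine Finset.sum_congr ?_ fun ω hω => ?_
        · ext; simp [cell]
        · have : g ω = a := by simpa [cell] using hω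
          rw [this]; ring
      rw [e, e]
      refine Finset.sum_le_sum fun a _ => ?_
      have : ∑ c, ρ (ι a) c * ∑ ω ∈ cell g a, μ₀ ω * uR (c, ω)
          = ∑ ω ∈ cell g a, μ₀ ω * uR (a, ω) := by
        simp [hρ, Function.leftInverse_invFun ι.injective _]
      rw [this]
      calc _ ≤ ∑ c, ρ' (ι a) c * ∑ ω ∈ cell g a, μ₀ ω * uR (a, ω) :=
            Finset.sum_le_sum fun c _ => mul_le_mul_of_nonneg_left (hf a c) ((hρ' _).1 c)
        _ = _ := by rw [← Finset.sum_mul, (hρ' _).2, one_mul]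
  have h1 : V ≤ ctPayoff (M := M) μ₀ uS uR := by
    refine le_csSup ⟨V, ?_⟩ ⟨σ, ρ, hct, (hUρ uS).symm⟩
    rintro x ⟨σ', ρ', h', rfl⟩
    exact hub σ' ρ' h'.1 h'.2.1
  have h2 : persPayoff (M := M) μ₀ uS uR ≤ V := by
    refine csSup_le ⟨_, σ, ρ, ⟨hct.1, hct.2.1, hct.2.2.2⟩, rfl⟩ ?_
    rintro x ⟨σ', ρ', h', rfl⟩
    exact hub σ' ρ' h'.1 h'.2.1
  exact not_lt.2 (h2.trans h1)

/-- Directions supported on `T` keeping Receiver indifferent between `a` and all of `I`. -/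
def Ker (uR : A × Ω → ℝ) (a : A) (I : Finset A) (T : Finset Ω) (d : Ω → ℝ) : Prop :=
  (∀ ω, ω ∉ T → d ω = 0) ∧ ∀ c ∈ I, ∑ ω, d ω * (uR (a, ω) - uR (c, ω)) = 0

/-- Genericity used for excluding mixing. -/
def Gen (uS uR : A × Ω → ℝ) : Prop :=
  ∀ (a b : A) (I : Finset A) (T : Finset Ω), a ≠ b → (∃ q, q ≠ 0 ∧ Ker uR a I T q) →
    ∃ d, Ker uR a I T d ∧ ∑ ω, d ω * (uS (a, ω) - uS (b, ω)) ≠ 0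

/-- Pairwise form of unique responses. -/
def PUR2 (μ₀ : Ω → ℝ) (uR : A × Ω → ℝ) : Prop :=
  ∀ (S : Finset Ω) (a b : A), S.Nonempty → a ≠ b →
    ∑ ω ∈ S, μ₀ ω * uR (a, ω) ≠ ∑ ω ∈ S, μ₀ ω * uR (b, ω)

theorem eventually_nonneg {x y : ℝ} (h : 0 < x ∨ (0 ≤ x ∧ 0 ≤ y)) :
    ∀ᶠ t : ℝ in nhdsWithin 0 (Set.Ioi 0), 0 ≤ x + t * y := by
  rcases h with h | ⟨h1, h2⟩
  · have hc : Filter.Tendsto (fun t : ℝ => x + t * y) (nhdsWithin 0 (Set.Ioi 0)) (nhds x) := by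
      have : Continuous fun t : ℝ => x + t * y := by fun_prop
      have h0 := this.tendsto 0
      simp only [zero_mul, add_zero] at h0
      exact h0.mono_left nhdsWithin_le_nhds
    exact (hc.eventually (lt_mem_nhds h)).mono fun t ht => le_of_lt ht
  · filter_upwards [self_mem_nhdsWithin] with t ht
    have : (0:ℝ) < t := ht
    positivity

/-- An obedient optimum cannot be improved along an admissible direction. -/
theorem no_improve {μ₀ : Ω → ℝ} {uS uR : A × Ω → ℝ} {p D : A → Ω → ℝ}
    (hp : Obed μ₀ uR p) (hopt : ∀ p', Obed μ₀ uR p' → Vout uS p' ≤ Vout uS p)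
    (h0 : ∀ a ω, 0 < p a ω ∨ 0 ≤ D a ω) (h1 : ∀ ω, ∑ a, D a ω = 0)
    (h2 : ∀ a c, 0 < ∑ ω, p a ω * (uR (a, ω) - uR (c, ω)) ∨
      0 ≤ ∑ ω, D a ω * (uR (a, ω) - uR (c, ω))) : Vout uS D ≤ 0 := by
  by_contra hc
  push Not at hc
  have e1 : ∀ᶠ t : ℝ in nhdsWithin 0 (Set.Ioi 0), ∀ a ω, 0 ≤ p a ω + t * D a ω := by
    simp only [Filter.eventually_all]
    intro a ω
    exact eventually_nonneg ((h0 a ω).imp id fun h => ⟨hp.1 a ω, h⟩)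
  have e2 : ∀ᶠ t : ℝ in nhdsWithin 0 (Set.Ioi 0), ∀ a c,
      0 ≤ ∑ ω, p a ω * (uR (a, ω) - uR (c, ω)) + t * ∑ ω, D a ω * (uR (a, ω) - uR (c, ω)) := by
    simp only [Filter.eventually_all]
    intro a c
    exact eventually_nonneg ((h2 a c).imp id fun h => ⟨hp.2.2 a c, h⟩)
  obtain ⟨t, ⟨ht1, ht2⟩, ht⟩ := ((e1.and e2).and self_mem_nhdsWithin).exists
  have ht : (0:ℝ) < t := ht
  have := hopt (fun a ω => p a ω + t * D a ω) ⟨ht1, ?_, ?_⟩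
  · have e : Vout uS (fun a ω => p a ω + t * D a ω) = Vout uS p + t * Vout uS D := by
      simp only [Vout, Finset.mul_sum, ← Finset.sum_add_distrib]
      exact Finset.sum_congr rfl fun a _ => Finset.sum_congr rfl fun ω _ => by ring
    rw [e] at this
    nlinarith [mul_pos ht hc]
  · intro ω
    rw [Finset.sum_add_distrib, ← Finset.mul_sum, h1, hp.2.1]; simp
  · intro a c
    refine (ht2 a c).trans (le_of_eq ?_)
    rw [Finset.mul_sum, ← Finset.sum_add_distrib]
    exact Finset.sum_congr rfl fun ω _ => by ring

theorem obed_outc {μ₀ : Ω → ℝ} (hμ : IsPrior μ₀) {uR : A × Ω → ℝ} {σ : Ω → M → ℝ}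
    {ρ : M → A → ℝ} (h : PersProfile μ₀ uR σ ρ) : Obed μ₀ uR (outc μ₀ σ ρ) := by
  obtain ⟨hσ, hρ, hR⟩ := h
  refine ⟨fun a ω => Finset.sum_nonneg fun m _ =>
    mul_nonneg (mul_nonneg (hμ.1 ω).le ((hσ ω).1 m)) ((hρ m).1 a), fun ω => ?_, fun a c => ?_⟩
  · unfold outc
    rw [Finset.sum_comm]
    simp only [← Finset.mul_sum, (hρ _).2, (hσ _).2, mul_one]
  · unfold outc
    simp only [Finset.sum_mul]
    rw [Finset.sum_comm]
    refine Finset.sum_nonneg fun m _ => ?_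
    have e : ∑ ω, μ₀ ω * σ ω m * ρ m a * (uR (a, ω) - uR (c, ω)) =
        ρ m a * (∑ ω, μ₀ ω * σ ω m * uR (a, ω) - ∑ ω, μ₀ ω * σ ω m * uR (c, ω)) := by
      rw [← Finset.sum_sub_distrib, Finset.mul_sum]
      exact Finset.sum_congr rfl fun ω _ => by ring
    rw [e]
    rcases ((hρ m).1 a).eq_or_lt with h | h
    · rw [← h]; simp
    · exact mul_nonneg h.le (sub_nonneg.2 (rbr_local hρ hR m a c h))

theorem no_mixing {μ₀ : Ω → ℝ} (hμ : IsPrior μ₀) {uS uR : A × Ω → ℝ}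
    {σ : Ω → M → ℝ} {ρ : M → A → ℝ} (h : PersProfile μ₀ uR σ ρ)
    (hopt : ∀ p', Obed μ₀ uR p' → Vout uS p' ≤ Vout uS (outc μ₀ σ ρ))
    (hgen : Gen uS uR) (m : M) (hm : ∃ ω, 0 < σ ω m) (a b : A) (ha : 0 < ρ m a) (hb : 0 < ρ m b) :
    a = b := by
  classical
  by_contra hab
  have hob := obed_outc hμ h
  obtain ⟨hσ, hρ, hR⟩ := h
  set q : Ω → ℝ := fun ω => μ₀ ω * σ ω m with hq
  have hq0 : ∀ ω, 0 ≤ q ω := fun ω => mul_nonneg (hμ.1 ω).le ((hσ ω).1 m)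
  set T : Finset Ω := Finset.univ.filter fun ω => 0 < q ω with hT
  set I : Finset A := Finset.univ.filter fun c => ∑ ω, q ω * (uR (a, ω) - uR (c, ω)) = 0 with hI
  have hqT : ∀ ω, ω ∉ T → q ω = 0 := by
    intro ω hω
    simp only [hT, Finset.mem_filter, Finset.mem_univ, true_and, not_lt] at hω
    exact le_antisymm hω (hq0 ω)
  -- lower bounds for the outcome
  have hpa : ∀ x, 0 < ρ m x → ∀ ω ∈ T, 0 < outc μ₀ σ ρ x ω := by
    intro x hx ω hω
    simp only [hT, Finset.mem_filter, Finset.mem_univ, true_and] at hω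
    exact Finset.sum_pos' (fun m _ => mul_nonneg (mul_nonneg (hμ.1 ω).le ((hσ ω).1 m)) ((hρ m).1 x))
      ⟨m, Finset.mem_univ m, mul_pos hω hx⟩
  have hpR : ∀ x c, 0 < ρ m x → 0 < ∑ ω, q ω * (uR (x, ω) - uR (c, ω)) →
      0 < ∑ ω, outc μ₀ σ ρ x ω * (uR (x, ω) - uR (c, ω)) := by
    intro x c hx hpos
    unfold outc
    simp only [Finset.sum_mul]
    rw [Finset.sum_comm]
    have e : ∀ m, ∑ ω, μ₀ ω * σ ω m * ρ m x * (uR (x, ω) - uR (c, ω)) =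
        ρ m x * (∑ ω, μ₀ ω * σ ω m * (uR (x, ω) - uR (c, ω))) := by
      intro m
      rw [Finset.mul_sum]
      exact Finset.sum_congr rfl fun ω _ => by ring
    simp only [e]
    refine Finset.sum_pos' (fun m' _ => ?_) ⟨m, Finset.mem_univ m, mul_pos hx hpos⟩
    rcases ((hρ m').1 x).eq_or_lt with h | h
    · rw [← h]; simp
    · refine mul_nonneg h.le ?_
      have := rbr_local hρ hR m' x c h
      simp only [mul_sub, Finset.sum_sub_distrib]
      linarith
  have hge : ∀ x c, 0 < ρ m x → 0 ≤ ∑ ω, q ω * (uR (x, ω) - uR (c, ω)) := by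
    intro x c hx
    have := rbr_local hρ hR m x c hx
    simp only [mul_sub, Finset.sum_sub_distrib, hq]
    linarith
  have hswap : ∀ (f : Ω → ℝ) (x y z : A), ∑ ω, f ω * (uR (x, ω) - uR (z, ω)) =
      ∑ ω, f ω * (uR (x, ω) - uR (y, ω)) + ∑ ω, f ω * (uR (y, ω) - uR (z, ω)) := by
    intro f x y z
    rw [← Finset.sum_add_distrib]
    exact Finset.sum_congr rfl fun ω _ => by ring
  have hself : ∀ (f : Ω → ℝ) (x : A), ∑ ω, f ω * (uR (x, ω) - uR (x, ω)) = 0 := by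
    intro f x; simp
  have hbI : ∑ ω, q ω * (uR (a, ω) - uR (b, ω)) = 0 := by
    have h1 := hge a b ha
    have h2 := hge b a hb
    have h3 := hswap q a b a
    rw [hself] at h3
    linarith
  obtain ⟨d₀, hd₀, hL₀⟩ := hgen a b I T hab ⟨q, by
    obtain ⟨ω, hω⟩ := hm
    intro h0
    have := congrFun h0 ω
    have h3 : 0 < q ω := mul_pos (hμ.1 ω) hω
    rw [this] at h3
    simp at h3, hqT, fun c hc => by simpa [hI] using hc⟩
  obtain ⟨d, hd, hL⟩ : ∃ d, Ker uR a I T d ∧ 0 < ∑ ω, d ω * (uS (a, ω) - uS (b, ω)) := by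
    rcases lt_or_gt_of_ne hL₀ with h | h
    · refine ⟨fun ω => - d₀ ω, ⟨fun ω hω => by simp [hd₀.1 ω hω], fun c hc => ?_⟩, ?_⟩
      · simp [Finset.sum_neg_distrib, hd₀.2 c hc]
      · simp only [neg_mul, Finset.sum_neg_distrib]; linarith
    · exact ⟨d₀, hd₀, h⟩
  have hdb : ∑ ω, d ω * (uR (a, ω) - uR (b, ω)) = 0 := hd.2 b (by simp [hI, hbI])
  set D : A → Ω → ℝ := fun x ω => ((if x = a then 1 else 0) - (if x = b then 1 else 0)) * d ω with hD
  have hDa : D a = d := by funext ω; simp [hD, hab]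
  have hDb : D b = fun ω => - d ω := by funext ω; simp [hD, Ne.symm hab]
  have hDo : ∀ x, x ≠ a → x ≠ b → D x = fun _ => 0 := by
    intro x h1 h2; funext ω; simp [hD, h1, h2]
  have := no_improve hob hopt (D := D) ?_ ?_ ?_
  · have e : Vout uS D = ∑ ω, d ω * (uS (a, ω) - uS (b, ω)) := by
      unfold Vout
      rw [Finset.sum_comm]
      refine Finset.sum_congr rfl fun ω _ => ?_
      simp only [hD, sub_mul, ite_mul, one_mul, zero_mul, Finset.sum_sub_distrib,
        Finset.sum_ite_eq', Finset.mem_univ, if_true]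
      ring
    linarith
  · intro x ω
    by_cases hω : ω ∈ T
    · by_cases hxa : x = a
      · subst hxa; exact Or.inl (hpa _ ha ω hω)
      · by_cases hxb : x = b
        · subst hxb; exact Or.inl (hpa _ hb ω hω)
        · right; rw [hDo x hxa hxb]
    · right; simp [hD, hd.1 ω hω]
  · intro ω
    simp only [hD, ← Finset.sum_mul, Finset.sum_sub_distrib]
    simp
  · intro x c
    by_cases hxa : x = a
    · subst hxa
      rcases (hge x c ha).eq_or_lt with h | h
      · right
        rw [hDa, hd.2 c (by simp [hI, ← h])]
      · exact Or.inl (hpR x c ha h)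
    · by_cases hxb : x = b
      · subst hxb
        rcases (hge x c hb).eq_or_lt with h | h
        · right
          have hac : ∑ ω, d ω * (uR (a, ω) - uR (c, ω)) = 0 := by
            refine hd.2 c ?_
            simp only [hI, Finset.mem_filter, Finset.mem_univ, true_and]
            rw [hswap q a x c, hbI, ← h]; simp
          have h3 := hswap d a x c
          rw [hDb]
          simp only [neg_mul, Finset.sum_neg_distrib]
          linarith
        · exact Or.inl (hpR x c hb h)
      · right; rw [hDo x hxa hxb]; simp

theorem fel_of_no_value [Nonempty A] {μ₀ : Ω → ℝ} (hμ : IsPrior μ₀) {uS uR : A × Ω → ℝ}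
    {g : Ω → A} (hcard : Fintype.card A ≤ Fintype.card M) (hg : Fav uS g)
    (hnt : ∀ ω a b, a ≠ b → uS (a, ω) ≠ uS (b, ω))
    (hgen : Gen uS uR) (hpur : PUR2 μ₀ uR)
    (hji : ∀ a, ∃ ω, g ω = a ∧ ∀ c, c ≠ a → uR (c, ω) < uR (a, ω))
    (hnv : ¬ (ctPayoff (M := M) μ₀ uS uR < persPayoff (M := M) μ₀ uS uR)) :
    Fel μ₀ uR g id := by
  classical
  obtain ⟨ι⟩ := Function.Embedding.nonempty_of_card_le hcard
  have : Nonempty M := ‹Nonempty A›.map ι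
  obtain ⟨σ, ρ, hct, hval⟩ := exists_ct_attain (M := M) μ₀ uS uR
  have hpp : PersProfile μ₀ uR σ ρ := ⟨hct.1, hct.2.1, hct.2.2.2⟩
  obtain ⟨hσ, hρ, hS, hR⟩ := hct
  have hopt : ∀ p', Obed μ₀ uR p' → Vout uS p' ≤ Vout uS (outc μ₀ σ ρ) := by
    intro p' hp'
    obtain ⟨σ', ρ', h', hV'⟩ := pers_of_obed hμ hcard hp'
    rw [Vout_outc, ← hV', hval]
    exact (le_persPayoff h').trans (not_lt.1 hnv)
  have hob := obed_outc hμ hpp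
  set p := outc μ₀ σ ρ with hp
  -- after an on-path message the action is pure
  have hpure : ∀ m a, (∃ ω, 0 < σ ω m) → 0 < ρ m a → ∀ u : A → ℝ, ∑ b, ρ m b * u b = u a := by
    intro m a hm ha u
    have h0 : ∀ b, b ≠ a → ρ m b = 0 := by
      intro b hb
      by_contra hne
      exact hb (no_mixing hμ hpp hopt hgen m hm b a
        (lt_of_le_of_ne ((hρ m).1 b) (Ne.symm hne)) ha)
    have h1 : ρ m a = 1 := by
      rw [← (hρ m).2]
      exact (Finset.sum_eq_single a (fun b _ hb => h0 b hb) (by simp)).symm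
    rw [Finset.sum_eq_single a (fun b _ hb => by rw [h0 b hb, zero_mul]) (by simp), h1, one_mul]
  have hwit : ∀ a ω, 0 < p a ω → ∃ m, 0 < σ ω m ∧ 0 < ρ m a := by
    intro a ω h
    by_contra hc
    push Not at hc
    refine absurd h (not_lt.2 (Finset.sum_nonpos fun m _ => ?_))
    rcases ((hσ ω).1 m).eq_or_lt with h | h
    · rw [← h]; simp
    · exact mul_nonpos_of_nonneg_of_nonpos (mul_nonneg (hμ.1 ω).le h.le) (hc m h)
  have hbest : ∀ a ω b ω', 0 < p a ω → 0 < p b ω' → uS (b, ω) ≤ uS (a, ω) := by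
    intro a ω b ω' ha hb
    obtain ⟨m, hm, hma⟩ := hwit a ω ha
    obtain ⟨m', hm', hmb⟩ := hwit b ω' hb
    have := sbr_local hμ hσ hS ω m m' hm
    rwa [hpure m a ⟨ω, hm⟩ hma fun b => uS (b, ω),
      hpure m' b ⟨ω', hm'⟩ hmb fun b => uS (b, ω)] at this
  -- every action is played
  have hall : ∀ b, ∃ ω, 0 < p b ω := by
    intro b
    by_contra hc
    push Not at hc
    obtain ⟨ω, hgω, hRω⟩ := hji b
    have hpb : ∀ ω, p b ω = 0 := fun ω => le_antisymm (hc ω) (hob.1 b ω)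
    obtain ⟨a, ha⟩ : ∃ a, 0 < p a ω := by
      by_contra hn
      push Not at hn
      have h1 := hob.2.1 ω
      have h2 := hμ.1 ω
      have h3 : ∑ a, p a ω ≤ 0 := Finset.sum_nonpos fun a _ => hn a
      linarith
    have hab : a ≠ b := by
      rintro rfl
      rw [hpb] at ha
      exact lt_irrefl _ ha
    set D : A → Ω → ℝ := fun x ω' => ((if x = b then 1 else 0) - (if x = a then 1 else 0)) *
      (if ω' = ω then 1 else 0) with hD
    have := no_improve hob hopt (D := D) ?_ ?_ ?_
    · have e : Vout uS D = uS (b, ω) - uS (a, ω) := by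
        unfold Vout
        rw [Finset.sum_comm, Finset.sum_eq_single ω]
        · simp [hD, sub_mul, Finset.sum_sub_distrib]
        · intro ω' _ h; simp [hD, h]
        · simp
      have := hg ω a (by rw [hgω]; exact hab)
      rw [hgω] at this
      linarith
    · intro x ω'
      by_cases hω' : ω' = ω
      · subst hω'
        by_cases hx : x = a
        · subst hx; exact Or.inl ha
        · right; simp only [hD, hx, if_false]; split_ifs <;> norm_num
      · right; simp [hD, hω']
    · intro ω'
      simp only [hD, ← Finset.sum_mul, Finset.sum_sub_distrib]
      simp
    · intro x c
      have e : ∑ ω', D x ω' * (uR (x, ω') - uR (c, ω')) =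
          ((if x = b then 1 else 0) - (if x = a then 1 else 0)) * (uR (x, ω) - uR (c, ω)) := by
        rw [Finset.sum_eq_single ω]
        · simp [hD]
        · intro ω' _ h; simp [hD, h]
        · simp
      rw [e]
      by_cases hxb : x = b
      · right
        subst hxb
        simp only [if_true, Ne.symm hab, if_false, sub_zero, one_mul]
        by_cases hcx : c = x
        · rw [hcx]; simp
        · linarith [hRω c hcx]
      · by_cases hxa : x = a
        · subst hxa
          by_cases hcx : c = x
          · right; rw [hcx]; simp
          · left
            refine lt_of_le_of_ne (hob.2.2 x c) (Ne.symm ?_)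
            have hpx : ∀ ω', p x ω' = if 0 < p x ω' then μ₀ ω' else 0 := by
              intro ω'
              split_ifs with h
              · rw [← hob.2.1 ω']
                symm
                refine Finset.sum_eq_single x (fun b _ hb => ?_)
                  (fun h => absurd (Finset.mem_univ _) h)
                refine le_antisymm (not_lt.1 fun hpos => ?_) (hob.1 b ω')
                exact hnt ω' b x hb
                  (le_antisymm (hbest x ω' b ω' h hpos) (hbest b ω' x ω' hpos h))
              · exact le_antisymm (not_lt.1 h) (hob.1 x ω')
            intro h0
            have h1 : ∑ ω', p x ω' * (uR (x, ω') - uR (c, ω')) =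
                ∑ ω' ∈ Finset.univ.filter (fun ω' => 0 < p x ω'), μ₀ ω' * uR (x, ω') -
                ∑ ω' ∈ Finset.univ.filter (fun ω' => 0 < p x ω'), μ₀ ω' * uR (c, ω') := by
              rw [← Finset.sum_sub_distrib, Finset.sum_filter]
              refine Finset.sum_congr rfl fun ω' _ => ?_
              by_cases h2 : 0 < p x ω'
              · have h3 := hpx ω'
                rw [if_pos h2] at h3
                rw [if_pos h2, h3]; ring
              · have h3 := hpx ω'
                rw [if_neg h2] at h3
                rw [if_neg h2, h3]; ring
            refine hpur (Finset.univ.filter fun ω' => 0 < p x ω') x c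
              ⟨ω, by simpa using ha⟩ (Ne.symm hcx) ?_
            linarith
        · right; simp [hxa, hxb]
  have hpg : ∀ ω a, 0 < p a ω → a = g ω := by
    intro ω a ha
    by_contra hne
    obtain ⟨ω', hω'⟩ := hall (g ω)
    have := hbest a ω (g ω) ω' ha hω'
    have h2 := hg ω a hne
    linarith
  have hpeq : ∀ ω a, p a ω = if g ω = a then μ₀ ω else 0 := by
    intro ω a
    have h0 : ∀ b, b ≠ g ω → p b ω = 0 := fun b hb =>
      le_antisymm (not_lt.1 fun h => hb (hpg ω b h)) (hob.1 b ω)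
    by_cases h : g ω = a
    · subst h
      rw [if_pos rfl, ← hob.2.1 ω]
      exact (Finset.sum_eq_single _ (fun b _ hb => h0 b hb) (by simp)).symm
    · rw [if_neg h, h0 a (Ne.symm h)]
  intro a c
  have := hob.2.2 a c
  simp only [hpeq, mul_sub, Finset.sum_sub_distrib, ite_mul, zero_mul, ← Finset.sum_filter] at this
  simp only [cell, id]
  convert sub_nonneg.1 this using 2

/-! ### Measure-theoretic part -/

set_option linter.unusedSectionVars false

/-- The unit cube of utilities. -/
def Cu (Ω A : Type) : Set (A × Ω → ℝ) := {u | ∀ p, u p ∈ Set.Icc (0 : ℝ) 1}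

theorem Cu_eq (Ω A : Type) : Cu Ω A = Set.Icc (fun _ => 0) (fun _ => 1) := by
  ext u
  simp only [Cu, Set.mem_ofPred_eq, Set.mem_Icc, Pi.le_def, forall_and]

theorem vol_Cu : volume (Cu Ω A) = 1 := by
  rw [Cu_eq, Real.volume_Icc_pi]
  simp

theorem meas_Cu : MeasurableSet (Cu Ω A) := by
  rw [Cu_eq]
  exact measurableSet_Icc

/-- The permutation of coordinates induced by statewise permutations of actions. -/
def permE (θ : Ω → Equiv.Perm A) : A × Ω ≃ A × Ω where
  toFun p := (θ p.2 p.1, p.2)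
  invFun p := ((θ p.2).symm p.1, p.2)
  left_inv p := by simp
  right_inv p := by simp

theorem vol_perm (θ : Ω → Equiv.Perm A) (S : Set (A × Ω → ℝ)) :
    volume {u : A × Ω → ℝ | (fun p => u (θ p.2 p.1, p.2)) ∈ S} = volume S := by
  have h := (volume_measurePreserving_piCongrLeft (fun _ : A × Ω => ℝ) (permE θ).symm)
  have h2 := h.measure_preimage_equiv S
  rw [← h2]
  congr 1
  ext u
  have : (MeasurableEquiv.piCongrLeft (fun _ : A × Ω => ℝ) (permE θ).symm) u =
      fun p => u (θ p.2 p.1, p.2) := by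
    funext p
    have := MeasurableEquiv.piCongrLeft_apply_apply (permE θ).symm
      (β := fun _ : A × Ω => ℝ) u (permE θ p)
    rw [Equiv.symm_apply_apply] at this
    exact this
  rw [Set.mem_preimage, this]
  rfl

theorem hyper_null {I : Type} [Fintype I] (w : I → ℝ) (hw : w ≠ 0) :
    volume {u : I → ℝ | ∑ p, w p * u p = 0} = 0 := by
  classical
  set L : (I → ℝ) →ₗ[ℝ] ℝ := ∑ p, w p • LinearMap.proj p with hL
  have hLu : ∀ u, L u = ∑ p, w p * u p := by
    intro u; simp [hL]
  have h := Measure.addHaar_submodule (volume : Measure (I → ℝ)) (LinearMap.ker L) (by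
    intro ht
    apply hw
    funext p
    have : Pi.single p 1 ∈ LinearMap.ker L := by rw [ht]; trivial
    rw [LinearMap.mem_ker, hLu] at this
    simpa [Pi.single_apply] using this)
  convert h using 2
  ext u
  simp [hLu]

theorem diff_null (q : Ω → ℝ) (hq : q ≠ 0) (a b : A) (hab : a ≠ b) :
    volume {u : A × Ω → ℝ | ∑ ω, q ω * (u (a, ω) - u (b, ω)) = 0} = 0 := by
  classical
  have := hyper_null (fun p : A × Ω => q p.2 * ((if p.1 = a then 1 else 0) - (if p.1 = b then 1 else 0))) (by
    intro h
    apply hq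
    funext ω
    have := congrFun h (a, ω)
    simpa [hab] using this)
  convert this using 2
  ext u
  simp only [Set.mem_ofPred_eq]
  rw [Fintype.sum_prod_type_right]
  refine Eq.congr (Finset.sum_congr rfl fun ω _ => ?_) rfl
  simp [mul_sub, sub_mul, Finset.sum_sub_distrib]

/-- Utilities with ties. -/
def NT (Ω A : Type) : Set (A × Ω → ℝ) := {u | ∃ ω a b, a ≠ b ∧ u (a, ω) = u (b, ω)}

theorem vol_NT : volume (NT Ω A) = 0 := by
  classical
  have : NT Ω A ⊆ ⋃ (ω : Ω) (a : A) (b : A) (_ : a ≠ b),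
      {u : A × Ω → ℝ | ∑ ω', (Pi.single ω (1:ℝ) : Ω → ℝ) ω' * (u (a, ω') - u (b, ω')) = 0} := by
    rintro u ⟨ω, a, b, hab, h⟩
    simp only [Set.mem_iUnion]
    refine ⟨ω, a, b, hab, ?_⟩
    simp [Pi.single_apply, h]
  refine measure_mono_null this ?_
  simp only [measure_iUnion_null_iff]
  intro ω a b hab
  exact diff_null _ (by simp) a b hab

theorem vol_NP {μ₀ : Ω → ℝ} (hμ : IsPrior μ₀) :
    volume {u : A × Ω → ℝ | ¬ PUR2 μ₀ u} = 0 := by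
  classical
  have : {u : A × Ω → ℝ | ¬ PUR2 μ₀ u} ⊆ ⋃ (S : Finset Ω) (_ : S.Nonempty) (a : A) (b : A)
      (_ : a ≠ b), {u : A × Ω → ℝ |
        ∑ ω', (if ω' ∈ S then μ₀ ω' else 0) * (u (a, ω') - u (b, ω')) = 0} := by
    intro u hu
    simp only [PUR2, Set.mem_ofPred_eq] at hu
    push Not at hu
    obtain ⟨S, a, b, hS, hab, h⟩ := hu
    simp only [Set.mem_iUnion]
    refine ⟨S, hS, a, b, hab, ?_⟩
    simp only [Set.mem_ofPred_eq, ite_mul, zero_mul, Finset.sum_ite_mem, Finset.univ_inter,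
      mul_sub, Finset.sum_sub_distrib]
    linarith
  refine measure_mono_null this ?_
  simp only [measure_iUnion_null_iff]
  intro S hS a b hab
  refine diff_null _ ?_ a b hab
  intro h
  obtain ⟨ω, hω⟩ := hS
  have := congrFun h ω
  simp [hω, (hμ.1 ω).ne'] at this

theorem meas_proj {E : Type} [TopologicalSpace E] [MeasurableSpace E] [BorelSpace E]
    (F : Set (E × (Ω → ℝ))) (hF : IsClosed F) (f : E × (Ω → ℝ) → ℝ) (hf : Continuous f) :
    MeasurableSet {e : E | ∃ d, (e, d) ∈ F ∧ f (e, d) ≠ 0} := by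
  have h : {e : E | ∃ d, (e, d) ∈ F ∧ f (e, d) ≠ 0} = ⋃ n : ℕ,
      {e : E | ∃ d ∈ Metric.closedBall (0 : Ω → ℝ) n, (e, d) ∈ F ∧
        1 / ((n : ℝ) + 1) ≤ |f (e, d)|} := by
    ext e
    simp only [Set.mem_ofPred_eq, Set.mem_iUnion]
    constructor
    · rintro ⟨d, hd, hfd⟩
      obtain ⟨n₁, h₁⟩ := exists_nat_ge ‖d‖
      obtain ⟨n₂, h₂⟩ := exists_nat_one_div_lt (abs_pos.2 hfd)
      refine ⟨max n₁ n₂, d, ?_, hd, ?_⟩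
      · rw [mem_closedBall_zero_iff]
        exact h₁.trans (by exact_mod_cast le_max_left _ _)
      · refine le_trans ?_ h₂.le
        apply one_div_le_one_div_of_le (by positivity)
        have : (n₂ : ℝ) ≤ (max n₁ n₂ : ℕ) := by exact_mod_cast le_max_right _ _
        linarith
    · rintro ⟨n, d, -, hd, h⟩
      refine ⟨d, hd, fun h0 => ?_⟩
      rw [h0, abs_zero] at h
      have : (0:ℝ) < 1 / ((n:ℝ) + 1) := by positivity
      linarith
  rw [h]
  refine MeasurableSet.iUnion fun n => IsClosed.measurableSet ?_
  have : CompactSpace (Metric.closedBall (0 : Ω → ℝ) n) :=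
    isCompact_iff_compactSpace.1 (isCompact_closedBall _ _)
  have hc : IsClosed {x : E × Metric.closedBall (0 : Ω → ℝ) n |
      (x.1, (x.2 : Ω → ℝ)) ∈ F ∧ 1 / ((n : ℝ) + 1) ≤ |f (x.1, (x.2 : Ω → ℝ))|} := by
    have hcont : Continuous fun x : E × Metric.closedBall (0 : Ω → ℝ) n => (x.1, (x.2 : Ω → ℝ)) := by
      fun_prop
    exact (hF.preimage hcont).inter (isClosed_le continuous_const (hf.comp hcont).abs)
  convert isClosedMap_fst_of_compactSpace _ hc using 1
  ext e
  constructor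
  · rintro ⟨d, hd, h1⟩
    exact ⟨(e, ⟨d, hd⟩), h1, rfl⟩
  · rintro ⟨⟨e', d, hd⟩, h1, rfl⟩
    exact ⟨d, hd, h1⟩

theorem vol_not_gen : volume {e : (A × Ω → ℝ) × (A × Ω → ℝ) | ¬ Gen e.1 e.2} = 0 := by
  have : {e : (A × Ω → ℝ) × (A × Ω → ℝ) | ¬ Gen e.1 e.2} ⊆
      ⋃ (a : A) (b : A) (I : Finset A) (T : Finset Ω) (_ : a ≠ b),
      ({e : (A × Ω → ℝ) × (A × Ω → ℝ) | ∃ q, Ker e.2 a I T q ∧ ‖q‖ ≠ 0} ∩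
        {e : (A × Ω → ℝ) × (A × Ω → ℝ) | ∃ d, Ker e.2 a I T d ∧
          ∑ ω, d ω * (e.1 (a, ω) - e.1 (b, ω)) ≠ 0}ᶜ) := by
    intro e he
    simp only [Gen, Set.mem_ofPred_eq] at he
    push Not at he
    obtain ⟨a, b, I, T, hab, ⟨q, hq, hqk⟩, h⟩ := he
    simp only [Set.mem_iUnion]
    refine ⟨a, b, I, T, hab, ⟨q, hqk, by simpa using hq⟩, ?_⟩
    rintro ⟨d, hd, hne⟩
    exact hne (h d hd)
  refine measure_mono_null this ?_
  simp only [measure_iUnion_null_iff]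
  intro a b I T hab
  have hF : IsClosed {x : ((A × Ω → ℝ) × (A × Ω → ℝ)) × (Ω → ℝ) | Ker x.1.2 a I T x.2} := by
    simp only [Ker, Set.ofPred_and, Set.ofPred_forall]
    refine IsClosed.inter ?_ ?_
    · refine isClosed_iInter fun ω => isClosed_iInter fun _ => isClosed_eq ?_ ?_ <;> fun_prop
    · refine isClosed_iInter fun ω => isClosed_iInter fun _ => isClosed_eq ?_ ?_ <;> fun_prop
  have m1 := meas_proj _ hF (fun x => ‖x.2‖) (by fun_prop)
  have m2 := meas_proj _ hF (fun x => ∑ ω, x.2 ω * (x.1.1 (a, ω) - x.1.1 (b, ω))) (by fun_prop)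
  rw [Measure.volume_eq_prod]
  refine (Measure.prod_apply_symm (m1.inter m2.compl)).trans ?_
  rw [lintegral_eq_zero_iff' (by exact (measurable_measure_prodMk_right (m1.inter m2.compl)).aemeasurable)]
  refine Filter.Eventually.of_forall fun uR => ?_
  by_cases hq : ∃ q, Ker uR a I T q ∧ ‖q‖ ≠ 0
  · obtain ⟨q, hqk, hq⟩ := hq
    refine measure_mono_null ?_ (diff_null q (by simpa using hq) a b hab)
    rintro uS ⟨-, h⟩
    by_contra hne
    exact h ⟨q, hqk, hne⟩
  · refine measure_mono_null ?_ measure_empty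
    rintro uS ⟨h, -⟩
    exact absurd h hq

theorem vol_sym {K : Type} [Fintype K] (S : K → Set (A × Ω → ℝ)) (hS : ∀ k, S k ⊆ Cu Ω A)
    (hm : ∀ k, MeasurableSet (S k)) (heq : ∀ k k', volume (S k) = volume (S k'))
    (hd : Pairwise (Function.onFun (AEDisjoint volume) S)) (Z : Set (A × Ω → ℝ)) (hZ : volume Z = 0)
    (hcov : Cu Ω A ⊆ (⋃ k, S k) ∪ Z) (k : K) :
    volume (S k) = (Fintype.card K : ENNReal)⁻¹ := by
  have h1 : volume (⋃ k, S k) = 1 := by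
    refine le_antisymm ?_ ?_
    · rw [← vol_Cu (Ω := Ω) (A := A)]
      exact measure_mono (Set.iUnion_subset hS)
    · rw [← vol_Cu (Ω := Ω) (A := A)]
      refine (measure_mono hcov).trans ((measure_union_le _ _).trans ?_)
      rw [hZ, add_zero]
  rw [measure_iUnion₀ hd fun k => (hm k).nullMeasurableSet, tsum_fintype,
    Finset.sum_congr rfl fun k' _ => heq k' k] at h1
  simp only [Finset.sum_const, nsmul_eq_mul, Finset.card_univ] at h1
  exact ENNReal.eq_inv_of_mul_eq_one_left (by rwa [mul_comm])

/-- Cube utilities with strict favourites given by `g`. -/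
def GS (g : Ω → A) : Set (A × Ω → ℝ) := Cu Ω A ∩ {u | Fav u g}

/-- Cube utilities for which `k a` is optimal on cell `a` of `g`. -/
def ES (μ₀ : Ω → ℝ) (g : Ω → A) (k : A → A) : Set (A × Ω → ℝ) := Cu Ω A ∩ {u | Fel μ₀ u g k}

theorem exists_fav [Nonempty A] {u : A × Ω → ℝ} (hu : u ∉ NT Ω A) : ∃ g, Fav u g := by
  have : ∀ ω, ∃ a, ∀ b, u (b, ω) ≤ u (a, ω) := by
    intro ω
    obtain ⟨a, -, ha⟩ := Finset.exists_max_image (Finset.univ : Finset A)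
      (fun a => u (a, ω)) Finset.univ_nonempty
    exact ⟨a, fun b => ha b (Finset.mem_univ b)⟩
  choose g hg using this
  refine ⟨g, fun ω b hb => lt_of_le_of_ne (hg ω b) fun h => hu ⟨ω, b, g ω, hb, h⟩⟩

theorem fav_unique {u : A × Ω → ℝ} {g g' : Ω → A} (h : Fav u g) (h' : Fav u g') : g = g' := by
  funext ω
  by_contra hne
  have h1 := h ω (g' ω) (Ne.symm hne)
  have h2 := h' ω (g ω) hne
  linarith

theorem meas_GS (g : Ω → A) : MeasurableSet (GS g) := by
  refine meas_Cu.inter ?_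
  simp only [Fav, Set.ofPred_forall]
  refine MeasurableSet.iInter fun ω => MeasurableSet.iInter fun b => MeasurableSet.iInter fun _ => ?_
  exact measurableSet_lt (by fun_prop) (by fun_prop)

theorem meas_ES (μ₀ : Ω → ℝ) (g : Ω → A) (k : A → A) : MeasurableSet (ES μ₀ g k) := by
  refine meas_Cu.inter ?_
  simp only [Fel, Set.ofPred_forall]
  refine MeasurableSet.iInter fun ω => MeasurableSet.iInter fun b => ?_
  exact measurableSet_le (by fun_prop) (by fun_prop)

theorem Cu_perm (θ : Ω → Equiv.Perm A) (u : A × Ω → ℝ) :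
    (fun p : A × Ω => u (θ p.2 p.1, p.2)) ∈ Cu Ω A ↔ u ∈ Cu Ω A := by
  constructor
  · rintro h ⟨a, ω⟩
    simpa using h ((θ ω).symm a, ω)
  · rintro h ⟨a, ω⟩
    exact h _

theorem vol_GS [Nonempty A] (g : Ω → A) :
    volume (GS g) = (Fintype.card A ^ Fintype.card Ω : ENNReal)⁻¹ := by
  classical
  obtain ⟨a₀⟩ := ‹Nonempty A›
  have heq : ∀ g : Ω → A, volume (GS g) = volume (GS fun _ : Ω => a₀) := by
    intro g
    rw [← vol_perm (fun ω => Equiv.swap a₀ (g ω)) (GS fun _ : Ω => a₀)]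
    congr 1
    ext u
    simp only [GS, Set.mem_inter_iff, Set.mem_ofPred_eq]
    refine and_congr (Cu_perm (fun ω => Equiv.swap a₀ (g ω)) u).symm (forall_congr' fun ω => ?_)
    simp only [Equiv.swap_apply_left]
    constructor
    · intro h b hb
      refine h _ fun hc => hb ?_
      rw [Equiv.swap_apply_eq_iff, Equiv.swap_apply_right] at hc
      exact hc
    · intro h b hb
      have := h (Equiv.swap a₀ (g ω) b) fun hc => hb (by
        rw [Equiv.swap_apply_eq_iff, Equiv.swap_apply_left] at hc
        exact hc)
      simpa using this
  have : Nonempty A := ⟨a₀⟩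
  have := vol_sym (GS : (Ω → A) → Set (A × Ω → ℝ)) (fun g => Set.inter_subset_left) meas_GS
    (fun k k' => by rw [heq k, heq k']) ?_ (NT Ω A) vol_NT ?_ g
  · rw [this]; simp
  · intro g g' hne
    refine Disjoint.aedisjoint (Set.disjoint_left.2 fun u h h' => hne (fav_unique h.2 h'.2))
  · intro u hu
    by_cases h : u ∈ NT Ω A
    · exact Or.inr h
    · obtain ⟨g, hg⟩ := exists_fav h
      exact Or.inl (Set.mem_iUnion.2 ⟨g, hu, hg⟩)

theorem mem_cell {g : Ω → A} {a : A} {ω : Ω} : ω ∈ cell g a ↔ g ω = a := by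
  simp [cell]

theorem vol_ES [Nonempty A] {μ₀ : Ω → ℝ} (hμ : IsPrior μ₀) (g : Ω → A)
    (hg : Function.Surjective g) :
    volume (ES μ₀ g id) = (Fintype.card A ^ Fintype.card A : ENNReal)⁻¹ := by
  classical
  have heq : ∀ k : A → A, volume (ES μ₀ g k) = volume (ES μ₀ g id) := by
    intro k
    rw [← vol_perm (fun ω => Equiv.swap (g ω) (k (g ω))) (ES μ₀ g id)]
    congr 1
    ext u
    simp only [ES, Set.mem_inter_iff, Set.mem_ofPred_eq]
    refine and_congr (Cu_perm (fun ω => Equiv.swap (g ω) (k (g ω))) u).symm (forall_congr' fun a => ?_)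
    have e : ∀ c, ∑ ω ∈ cell g a, μ₀ ω * u (Equiv.swap (g ω) (k (g ω)) c, ω) =
        ∑ ω ∈ cell g a, μ₀ ω * u (Equiv.swap a (k a) c, ω) := by
      intro c
      refine Finset.sum_congr rfl fun ω hω => ?_
      rw [mem_cell.1 hω]
    simp only [e, id, Equiv.swap_apply_left]
    constructor
    · intro h c
      exact h _
    · intro h c
      simpa using h (Equiv.swap a (k a) c)
  have := vol_sym (ES μ₀ g) (fun g => Set.inter_subset_left) (meas_ES μ₀ g)
    (fun k k' => by rw [heq k, heq k']) ?_ ∅ (by simp) ?_ id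
  · rw [this]; simp
  · intro k k' hne
    refine measure_mono_null ?_ (vol_NP (A := A) hμ)
    rintro u ⟨h, h'⟩ hp
    apply hne
    funext a
    by_contra hka
    obtain ⟨ω, hω⟩ := hg a
    exact hp (cell g a) (k a) (k' a) ⟨ω, mem_cell.2 hω⟩ hka
      (le_antisymm (h'.2 a (k a)) (h.2 a (k' a)))
  · intro u hu
    have : ∀ a, ∃ b, ∀ c, ∑ ω ∈ cell g a, μ₀ ω * u (c, ω) ≤ ∑ ω ∈ cell g a, μ₀ ω * u (b, ω) := by
      intro a
      obtain ⟨b, -, hb⟩ := Finset.exists_max_image (Finset.univ : Finset A)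
        (fun c => ∑ ω ∈ cell g a, μ₀ ω * u (c, ω)) Finset.univ_nonempty
      exact ⟨b, fun c => hb c (Finset.mem_univ c)⟩
    choose k hk using this
    exact Or.inl (Set.mem_iUnion.2 ⟨k, hu, hk⟩)

open Classical in
theorem card_miss {B : Type} [Fintype B] (t : A → B) :
    (Finset.univ.filter fun f : Ω → B => ∃ a, ∀ ω, f ω ≠ t a).card ≤
      Fintype.card A * (Fintype.card B - 1) ^ Fintype.card Ω := by
  have h : (Finset.univ.filter fun f : Ω → B => ∃ a, ∀ ω, f ω ≠ t a) ⊆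
      Finset.univ.biUnion fun a : A => Fintype.piFinset fun _ : Ω => Finset.univ.erase (t a) := by
    intro f hf
    simpa using hf
  refine (Finset.card_le_card h).trans (Finset.card_biUnion_le.trans ?_)
  simp [Fintype.card_piFinset, Finset.card_erase_of_mem]

open Classical in
theorem card_bad :
    (Finset.univ.filter fun f : Ω → A × A => ∃ a, ∀ ω, f ω ≠ (a, a)).card ≤
      Fintype.card A * (Fintype.card A ^ 2 - 1) ^ Fintype.card Ω := by
  have := card_miss (Ω := Ω) (fun a : A => (a, a))
  rw [Fintype.card_prod, ← sq] at this
  refine le_trans (le_of_eq ?_) this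
  congr!

open Classical in
theorem share_bounds [Nonempty A] {μ₀ : Ω → ℝ} (hμ : IsPrior μ₀)
    (hcard : Fintype.card A ≤ Fintype.card M) :
    let X := EnvCube Ω A ∩
      {e | ¬ (ctPayoff (M := M) μ₀ e.1 e.2 < persPayoff (M := M) μ₀ e.1 e.2)}
    let s := (Finset.univ.filter fun g : Ω → A => Function.Surjective g).card
    let n := Fintype.card A
    let N := Fintype.card Ω
    (s : ENNReal) * ((n ^ N : ENNReal)⁻¹ * (n ^ n : ENNReal)⁻¹) ≤ volume X ∧
    volume X ≤ (s : ENNReal) * ((n ^ N : ENNReal)⁻¹ * (n ^ n : ENNReal)⁻¹) +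
      ((n * (n ^ 2 - 1) ^ N : ℕ) : ENNReal) * ((n ^ N : ENNReal)⁻¹ * (n ^ N : ENNReal)⁻¹) := by
  intro X s n N
  set Sg : Finset (Ω → A) := Finset.univ.filter fun g : Ω → A => Function.Surjective g with hSg
  set Bd : Finset (Ω → A × A) := Finset.univ.filter fun f : Ω → A × A => ∃ a, ∀ ω, f ω ≠ (a, a)
    with hBd
  have hY : volume (⋃ g ∈ Sg, GS g ×ˢ ES μ₀ g id) =
      (s : ENNReal) * ((n ^ N : ENNReal)⁻¹ * (n ^ n : ENNReal)⁻¹) := by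
    rw [measure_biUnion_finset]
    · rw [Finset.sum_congr rfl (g := fun _ => ((n ^ N : ENNReal)⁻¹ * (n ^ n : ENNReal)⁻¹))]
      · rw [Finset.sum_const, nsmul_eq_mul]
      · intro g hg
        rw [Measure.volume_eq_prod, Measure.prod_prod, vol_GS,
          vol_ES hμ g (by simpa [hSg] using hg)]
    · intro g _ g' _ hne
      refine Set.disjoint_left.2 fun e h h' => hne (fav_unique h.1.2 h'.1.2)
    · intro g _
      exact (meas_GS g).prod (meas_ES μ₀ g id)
  have hZ : volume (⋃ f ∈ Bd, GS (fun ω => (f ω).1) ×ˢ GS (fun ω => (f ω).2)) ≤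
      ((n * (n ^ 2 - 1) ^ N : ℕ) : ENNReal) * ((n ^ N : ENNReal)⁻¹ * (n ^ N : ENNReal)⁻¹) := by
    refine (measure_biUnion_finset_le _ _).trans ?_
    rw [Finset.sum_congr rfl (g := fun _ => ((n ^ N : ENNReal)⁻¹ * (n ^ N : ENNReal)⁻¹))]
    · rw [Finset.sum_const, nsmul_eq_mul]
      exact mul_le_mul_left (Nat.cast_le.2 (card_bad (Ω := Ω) (A := A))) _
    · intro f _
      rw [Measure.volume_eq_prod, Measure.prod_prod, vol_GS, vol_GS]
  constructor
  · rw [← hY]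
    refine measure_mono (Set.iUnion₂_subset fun g _ => ?_)
    rintro ⟨uS, uR⟩ ⟨h1, h2⟩
    exact ⟨⟨h1.1, h2.1⟩, no_value_of_fel hμ hcard h1.2 h2.2⟩
  · have hsub : X ⊆ ((⋃ g ∈ Sg, GS g ×ˢ ES μ₀ g id) ∪
        (⋃ f ∈ Bd, GS (fun ω => (f ω).1) ×ˢ GS (fun ω => (f ω).2))) ∪
        ((NT Ω A ×ˢ Set.univ ∪ Set.univ ×ˢ NT Ω A) ∪
          (Set.univ ×ˢ {u | ¬ PUR2 μ₀ u} ∪ {e | ¬ Gen e.1 e.2})) := by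
      rintro ⟨uS, uR⟩ ⟨⟨hS, hR⟩, hnv⟩
      by_cases hn1 : uS ∈ NT Ω A
      · exact Or.inr (Or.inl (Or.inl ⟨hn1, trivial⟩))
      by_cases hn2 : uR ∈ NT Ω A
      · exact Or.inr (Or.inl (Or.inr ⟨trivial, hn2⟩))
      by_cases hn3 : PUR2 μ₀ uR
      swap
      · exact Or.inr (Or.inr (Or.inl ⟨trivial, hn3⟩))
      by_cases hn4 : Gen uS uR
      swap
      · exact Or.inr (Or.inr (Or.inr hn4))
      obtain ⟨g, hg⟩ := exists_fav hn1
      obtain ⟨h, hh⟩ := exists_fav hn2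
      left
      by_cases hb : ∃ a, ∀ ω, (g ω, h ω) ≠ (a, a)
      · right
        simp only [Set.mem_iUnion]
        exact ⟨fun ω => (g ω, h ω), by simpa [hBd] using hb, ⟨hS, hg⟩, ⟨hR, hh⟩⟩
      · left
        push Not at hb
        simp only [Set.mem_iUnion]
        refine ⟨g, ?_, ⟨hS, hg⟩, hR, ?_⟩
        · simp only [hSg, Finset.mem_filter, Finset.mem_univ, true_and]
          intro a
          obtain ⟨ω, hω⟩ := hb a
          exact ⟨ω, (Prod.ext_iff.1 hω).1⟩
        · refine fel_of_no_value hμ hcard hg ?_ hn4 hn3 ?_ hnv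
          · intro ω a b hab heq
            exact hn1 ⟨ω, a, b, hab, heq⟩
          · intro a
            obtain ⟨ω, hω⟩ := hb a
            obtain ⟨h1, h2⟩ := Prod.ext_iff.1 hω
            refine ⟨ω, h1, fun c hc => ?_⟩
            have := hh ω c (by rw [show h ω = a from h2]; exact hc)
            rwa [show h ω = a from h2] at this
    have hnull : volume ((NT Ω A ×ˢ Set.univ ∪ Set.univ ×ˢ NT Ω A) ∪
          (Set.univ ×ˢ {u : A × Ω → ℝ | ¬ PUR2 μ₀ u} ∪
            {e : (A × Ω → ℝ) × (A × Ω → ℝ) | ¬ Gen e.1 e.2})) = 0 := by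
      refine measure_union_null (measure_union_null ?_ ?_) (measure_union_null ?_ vol_not_gen)
      · rw [Measure.volume_eq_prod, Measure.prod_prod, vol_NT, zero_mul]
      · rw [Measure.volume_eq_prod, Measure.prod_prod, vol_NT, mul_zero]
      · rw [Measure.volume_eq_prod, Measure.prod_prod, vol_NP hμ, mul_zero]
    refine (measure_mono hsub).trans ((measure_union_le _ _).trans ?_)
    rw [hnull, add_zero]
    refine (measure_union_le _ _).trans ?_
    rw [hY]
    gcongr

open Classical in
theorem surj_count [Nonempty A] :
    (Fintype.card A : ℝ) ^ Fintype.card Ω -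
      Fintype.card A * ((Fintype.card A : ℝ) - 1) ^ Fintype.card Ω ≤
    ((Finset.univ.filter fun g : Ω → A => Function.Surjective g).card : ℝ) ∧
    ((Finset.univ.filter fun g : Ω → A => Function.Surjective g).card : ℝ) ≤
      (Fintype.card A : ℝ) ^ Fintype.card Ω := by
  have h1 := card_miss (Ω := Ω) (id : A → A)
  have h2 := Finset.card_filter_add_card_filter_not (s := (Finset.univ : Finset (Ω → A)))
    (fun g => Function.Surjective g)
  have h3 : (Finset.univ.filter fun g : Ω → A => ¬ Function.Surjective g) =
      (Finset.univ.filter fun f : Ω → A => ∃ a, ∀ ω, f ω ≠ id a) := by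
    ext f
    simp [Function.Surjective]
  rw [h3, Finset.card_univ, Fintype.card_fun] at h2
  have h1' : (((Finset.univ.filter fun f : Ω → A => ∃ a, ∀ ω, f ω ≠ id a).card : ℕ) : ℝ) ≤
      Fintype.card A * ((Fintype.card A : ℝ) - 1) ^ Fintype.card Ω := by
    have : ((Fintype.card A - 1 : ℕ) : ℝ) = (Fintype.card A : ℝ) - 1 := by
      rw [Nat.cast_sub Fintype.card_pos]; simp
    rw [← this]
    exact_mod_cast h1
  have h2' := congrArg (Nat.cast : ℕ → ℝ) h2
  push_cast at h2'
  constructor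
  · linarith
  · have : (0:ℝ) ≤ ((Finset.univ.filter fun f : Ω → A => ∃ a, ∀ ω, f ω ≠ id a).card : ℝ) := by
      positivity
    linarith

/-- Theorem 3(ii) (Kamenica–Lin): as `|Ω| → ∞`, the share of environments where
commitment has no value converges to `1/|A|^|A|`. -/
theorem share_no_value_of_commitment_limit
    (A : Type) [Fintype A] [Nonempty A] :
    ∀ ε : ℝ, 0 < ε → ∃ N : ℕ,
      ∀ (Ω : Type) [Fintype Ω] [Nonempty Ω], N ≤ Fintype.card Ω →
      ∀ (M : Type) [Fintype M],
        max (Fintype.card Ω) (Fintype.card A) < Fintype.card M →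
      ∀ μ₀ : Ω → ℝ, IsPrior μ₀ →
        |(volume (EnvCube Ω A ∩
            {e | ¬ (ctPayoff (M := M) μ₀ e.1 e.2 < persPayoff (M := M) μ₀ e.1 e.2)})).toReal
          - 1 / (Fintype.card A : ℝ) ^ Fintype.card A| ≤ ε := by
  classical
  intro ε hε
  set n : ℝ := (Fintype.card A : ℝ) with hn
  have hn1 : (1:ℝ) ≤ n := by
    rw [hn]; exact_mod_cast (Fintype.card_pos : 0 < Fintype.card A)
  have hn0 : (0:ℝ) < n := by linarith
  have ht1 : Filter.Tendsto (fun N : ℕ => n * (1 - 1 / n) ^ N) Filter.atTop (nhds 0) := by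
    have := (tendsto_pow_atTop_nhds_zero_of_lt_one (r := 1 - 1 / n)
      (by rw [sub_nonneg, div_le_one hn0]; exact hn1)
      (by have : 0 < 1 / n := by positivity
          linarith)).const_mul n
    simpa using this
  have ht2 : Filter.Tendsto (fun N : ℕ => n * (1 - 1 / n ^ 2) ^ N) Filter.atTop (nhds 0) := by
    have := (tendsto_pow_atTop_nhds_zero_of_lt_one (r := 1 - 1 / n ^ 2)
      (by rw [sub_nonneg, div_le_one (by positivity)]; nlinarith)
      (by have : 0 < 1 / n ^ 2 := by positivity
          linarith)).const_mul n
    simpa using this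
  obtain ⟨N₀, hN₀⟩ := Filter.eventually_atTop.1
    ((ht1.eventually (gt_mem_nhds hε)).and (ht2.eventually (gt_mem_nhds hε)))
  refine ⟨N₀, ?_⟩
  intro Ω _ _ hΩ M _ hM μ₀ hμ
  obtain ⟨hb1, hb2⟩ := hN₀ _ hΩ
  have hcard : Fintype.card A ≤ Fintype.card M := (le_max_right _ _).trans hM.le
  obtain ⟨hlo, hhi⟩ := share_bounds (M := M) hμ hcard
  obtain ⟨hs1, hs2⟩ := surj_count (Ω := Ω) (A := A)
  set X := EnvCube Ω A ∩
      {e | ¬ (ctPayoff (M := M) μ₀ e.1 e.2 < persPayoff (M := M) μ₀ e.1 e.2)} with hX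
  set s := (Finset.univ.filter fun g : Ω → A => Function.Surjective g).card with hs
  set N := Fintype.card Ω with hN
  have hne : (Fintype.card A : ENNReal) ≠ 0 := by simp
  have hfin1 : (s : ENNReal) * (((Fintype.card A : ENNReal) ^ N)⁻¹ *
      ((Fintype.card A : ENNReal) ^ Fintype.card A)⁻¹) ≠ ⊤ :=
    ENNReal.mul_ne_top (by simp) (ENNReal.mul_ne_top (by simp) (by simp))
  have hfin2 : ((Fintype.card A * (Fintype.card A ^ 2 - 1) ^ N : ℕ) : ENNReal) *
      (((Fintype.card A : ENNReal) ^ N)⁻¹ * ((Fintype.card A : ENNReal) ^ N)⁻¹) ≠ ⊤ :=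
    ENNReal.mul_ne_top (ENNReal.natCast_ne_top _) (ENNReal.mul_ne_top (by simp) (by simp))
  have hXfin : volume X ≠ ⊤ := ne_top_of_le_ne_top (ENNReal.add_ne_top.2 ⟨hfin1, hfin2⟩) hhi
  have hlo' := ENNReal.toReal_mono hXfin hlo
  have hhi' := ENNReal.toReal_mono (ENNReal.add_ne_top.2 ⟨hfin1, hfin2⟩) hhi
  rw [ENNReal.toReal_add hfin1 hfin2] at hhi'
  have hsq : ((Fintype.card A ^ 2 - 1 : ℕ) : ℝ) = n ^ 2 - 1 := by
    rw [Nat.cast_sub (Nat.one_le_pow _ _ Fintype.card_pos)]; simp [hn]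
  simp only [ENNReal.toReal_mul, ENNReal.toReal_inv, ENNReal.toReal_pow, ENNReal.toReal_natCast,
    Nat.cast_mul, Nat.cast_pow, hsq, ← hn] at hlo' hhi'
  set x := (volume X).toReal
  set P : ℝ := n ^ N with hP
  set R : ℝ := n ^ Fintype.card A with hR
  have hP0 : 0 < P := by positivity
  have hR1 : 1 ≤ R := one_le_pow₀ hn1
  have e1 : n * (1 - 1 / n) ^ N = n * (n - 1) ^ N * P⁻¹ := by
    rw [show 1 - 1 / n = (n - 1) / n by field_simp, div_pow, hP]; ring
  have e2 : n * (1 - 1 / n ^ 2) ^ N = n * (n ^ 2 - 1) ^ N * (P⁻¹ * P⁻¹) := by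
    rw [show 1 - 1 / n ^ 2 = (n ^ 2 - 1) / n ^ 2 by field_simp, div_pow, hP]
    rw [← pow_mul, mul_comm 2 N, pow_mul]
    field_simp
  rw [e1] at hb1
  rw [e2] at hb2
  have hRi : R⁻¹ ≤ 1 := inv_le_one_of_one_le₀ hR1
  have hRi0 : 0 ≤ R⁻¹ := by positivity
  have hsP1 : (s : ℝ) * P⁻¹ ≤ 1 := by
    rw [← div_eq_mul_inv, div_le_one hP0]; exact hs2
  have hsP2 : 1 - ε ≤ (s : ℝ) * P⁻¹ := by
    have h1 : (P - n * (n - 1) ^ N) * P⁻¹ ≤ (s : ℝ) * P⁻¹ :=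
      mul_le_mul_of_nonneg_right hs1 (by positivity)
    have h2 : P * P⁻¹ = 1 := mul_inv_cancel₀ hP0.ne'
    rw [sub_mul, h2] at h1
    linarith
  rw [← mul_assoc] at hlo'
  rw [← mul_assoc (s : ℝ)] at hhi'
  rw [one_div, abs_le]
  constructor
  · nlinarith [mul_le_mul_of_nonneg_right hsP2 hRi0, mul_le_mul_of_nonneg_left hRi hε.le]
  · nlinarith [mul_le_mul_of_nonneg_right hsP1 hRi0]

end KL
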